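/- Let G be a word-hyperbolic group with marked finite generating set A, X = Γ(G,A) its Cayley graph with word metric d_X, δ ≥ 10 an integer such that all geodesic triangles in X are δ-trim, H ≤ G an E-quasiconvex subgroup, and Y = Γ(G/H,A) the relative Cayley graph. Then there is a constant K₂ = K₂(H) > 0 with the following property. Let Θ be a bigon in Y with near-geodesic sides α', β' from x₁ = Hg to x₂ = Hf, where g, f are d_X-shortest in their cosets, with labels w and u; let h₁, h₂ ∈ H satisfy h₁gw̄ = f = h₂gū, and set h = h₁⁻¹h₂ and f' = gw̄. Let σ = [g,hg], α = [g,f'], β = [hg,f'] be geodesics in X and let c be the point of the inscribed triple of the triangle [1,g] ∪ σ ∪ [1,hg] lying on σ. Then any subsegment ζ of σ having c as its midpoint and contained in the closed δ-neighborhood of α or in the closed δ-neighborhood of β has length l(ζ) ≤ K₂. -/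

import Mathlib

/-! ## Words over a marked generating set and word metrics -/

/-- Evaluation of a word in the letters `A × Bool` (a letter together with a sign,
`true` = the letter itself, `false` = its inverse) under a marking `π : A → G`. -/
def evalWord {A G : Type*} [Group G] (π : A → G) (w : List (A × Bool)) : G :=
  (w.map fun p => if p.2 then π p.1 else (π p.1)⁻¹).prod

/-- The word length `|g|_X` of `g ∈ G` with respect to the marked generating set `π : A → G`. -/
noncomputable def wordLen {A G : Type*} [Group G] (π : A → G) (g : G) : ℕ :=
  sInf {n | ∃ w : List (A × Bool), w.length = n ∧ evalWord π w = g}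

/-- The word metric `d_X` on the Cayley graph `X = Γ(G,A)` (restricted to vertices). -/
noncomputable def dX {A G : Type*} [Group G] (π : A → G) (g₁ g₂ : G) : ℕ :=
  wordLen π (g₁⁻¹ * g₂)

/-! ## Discrete geodesics, paths, near-geodesics, thinness, trimness -/

/-- A (discrete) geodesic from `x` to `y` in a graph-like metric `d`:
a sequence of vertices `γ 0 = x, …, γ (d x y) = y` with `d (γ i) (γ j) = |i - j|`. -/
def IsDiscGeodesic {X : Type*} (d : X → X → ℕ) (x y : X) (γ : ℕ → X) : Prop :=
  γ 0 = x ∧ γ (d x y) = y ∧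
    ∀ i j, i ≤ d x y → j ≤ d x y → d (γ i) (γ j) = Nat.dist i j

/-- A discrete edge-path of length `n`: consecutive vertices at distance at most `1`. -/
def IsDiscPath {X : Type*} (d : X → X → ℕ) (γ : ℕ → X) (n : ℕ) : Prop :=
  ∀ i < n, d (γ i) (γ (i + 1)) ≤ 1

/-- A near-geodesic from `x` to `y`: a path `p₁ p' p₂` where `p'` is geodesic and the
initial and terminal segments `p₁, p₂` have length at most `1`. -/
def IsNearGeodesicPath {X : Type*} (d : X → X → ℕ) (x y : X) (γ : ℕ → X) (n : ℕ) : Prop :=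
  γ 0 = x ∧ γ n = y ∧ IsDiscPath d γ n ∧
    ∃ a b : ℕ, a ≤ 1 ∧ b ≤ 1 ∧ a + b ≤ n ∧
      ∀ i j, a ≤ i → i ≤ j → j + b ≤ n → d (γ i) (γ j) = j - i

/-- All geodesic triangles of `(X,d)` are `δ`-thin: every side is contained in the closed
`δ`-neighbourhood of the union of the other two sides. -/
def DiscThinTriangles {X : Type*} (d : X → X → ℕ) (δ : ℝ) : Prop :=
  ∀ x y z (γ₁ γ₂ γ₃ : ℕ → X),
    IsDiscGeodesic d x y γ₁ → IsDiscGeodesic d y z γ₂ → IsDiscGeodesic d z x γ₃ →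
    ∀ i ≤ d x y, ∃ j,
      (j ≤ d y z ∧ (d (γ₁ i) (γ₂ j) : ℝ) ≤ δ) ∨
      (j ≤ d z x ∧ (d (γ₁ i) (γ₃ j) : ℝ) ≤ δ)

/-- All geodesic bigons of `(X,d)` are `δ`-thin: each side is contained in the closed
`δ`-neighbourhood of the other. -/
def DiscThinBigons {X : Type*} (d : X → X → ℕ) (δ : ℝ) : Prop :=
  ∀ x y (α β : ℕ → X), IsDiscGeodesic d x y α → IsDiscGeodesic d x y β →
    (∀ i ≤ d x y, ∃ j ≤ d x y, (d (α i) (β j) : ℝ) ≤ δ) ∧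
    (∀ i ≤ d x y, ∃ j ≤ d x y, (d (β i) (α j) : ℝ) ≤ δ)

/-- The Gromov product `(x,y)_z` with respect to the `ℕ`-valued metric `d`. -/
noncomputable def gromovProd {X : Type*} (d : X → X → ℕ) (x y z : X) : ℝ :=
  ((d z x : ℝ) + (d z y : ℝ) - (d x y : ℝ)) / 2

/-- All geodesic triangles of `(X,d)` are `δ`-trim: two points on two sides which are at the
same distance, at most the Gromov product `(x,y)_z`, from the common vertex `z`, are
`δ`-close (this is required for every labelling of the vertices of the triangle). -/
def DiscTrimTriangles {X : Type*} (d : X → X → ℕ) (δ : ℕ) : Prop :=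
  ∀ x y z (γ₁ γ₂ : ℕ → X), IsDiscGeodesic d z x γ₁ → IsDiscGeodesic d z y γ₂ →
    ∀ i, i ≤ d z x → i ≤ d z y → (i : ℝ) ≤ gromovProd d x y z →
      d (γ₁ i) (γ₂ i) ≤ δ

/-- `S ⊆ G` is `C`-quasiconvex w.r.t. `d`: every geodesic with endpoints in `S`
stays in the closed `C`-neighbourhood of `S`. -/
def DiscQuasiconvex {G : Type*} (d : G → G → ℕ) (S : Set G) (C : ℝ) : Prop :=
  ∀ x y (γ : ℕ → G), x ∈ S → y ∈ S → IsDiscGeodesic d x y γ →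
    ∀ i ≤ d x y, ∃ h ∈ S, (d (γ i) h : ℝ) ≤ C

/-! ## The relative Cayley graph (Schreier coset graph) -/

/-- The right coset `Hg` of `g`, as a vertex of the relative Cayley graph `Γ(G/H,A)`. -/
def rcoset {G : Type*} [Group G] (H : Subgroup G) (g : G) :
    Quotient (QuotientGroup.rightRel H) :=
  Quotient.mk (QuotientGroup.rightRel H) g

/-- Right multiplication `Hg ↦ Hga` on right cosets; this is the map tracing the
edges of the relative Cayley graph. -/
def cosetMul {G : Type*} [Group G] (H : Subgroup G)
    (x : Quotient (QuotientGroup.rightRel H)) (g : G) :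
    Quotient (QuotientGroup.rightRel H) :=
  Quotient.map (· * g) (fun a b hab => by
    have hab' : b * a⁻¹ ∈ H := QuotientGroup.rightRel_apply.mp hab
    show QuotientGroup.rightRel H (a * g) (b * g)
    rw [QuotientGroup.rightRel_apply]
    simpa [mul_inv_rev, mul_assoc] using hab') x

/-- The simplicial metric `d_Y` on (the vertices of) the relative Cayley graph
`Y = Γ(G/H, A)`: the least length of a word in the generators leading from one coset
to the other. -/
noncomputable def dY {A G : Type*} [Group G] (π : A → G) (H : Subgroup G)
    (x y : Quotient (QuotientGroup.rightRel H)) : ℕ :=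
  sInf {n | ∃ w : List (A × Bool), w.length = n ∧ cosetMul H x (evalWord π w) = y}

/-- `g` is a shortest element of its right coset `Hg` with respect to the word length. -/
def ShortestInCoset {A G : Type*} [Group G] (π : A → G) (H : Subgroup G) (g : G) : Prop :=
  ∀ h ∈ H, wordLen π g ≤ wordLen π (h * g)

/-- The path in `Y = Γ(G/H,A)` starting at the coset `Hg` and reading the word `w`. -/
def cosetPath {A G : Type*} [Group G] (π : A → G) (H : Subgroup G) (g : G)
    (w : List (A × Bool)) : ℕ → Quotient (QuotientGroup.rightRel H) :=
  fun n => cosetMul H (rcoset H g) (evalWord π (w.take n))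

/-- The set-up of Section 4: a bigon `Θ` in `Y = Γ(G/H,A)` with near-geodesic sides
labelled `w` and `u` from `x₁ = Hg` to `x₂ = Hf`, where `g, f` are `d_X`-shortest in their
cosets, and `h₁, h₂ ∈ H` satisfy `h₁·g·w̄ = f = h₂·g·ū`. -/
def BigonSetup {A G : Type*} [Group G] [Fintype A] (π : A → G) (H : Subgroup G)
    (g f : G) (w u : List (A × Bool)) (h₁ h₂ : G) : Prop :=
  ShortestInCoset π H g ∧ ShortestInCoset π H f ∧
  h₁ ∈ H ∧ h₂ ∈ H ∧
  h₁ * (g * evalWord π w) = f ∧ h₂ * (g * evalWord π u) = f ∧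
  IsNearGeodesicPath (dY π H) (rcoset H g) (rcoset H f) (cosetPath π H g w) w.length ∧
  IsNearGeodesicPath (dY π H) (rcoset H g) (rcoset H f) (cosetPath π H g u) u.length

/-! ## The word metric -/

section WordMetric

variable {A G : Type*} [Group G] {π : A → G}

lemma evalWord_append (π : A → G) (v w : List (A × Bool)) :
    evalWord π (v ++ w) = evalWord π v * evalWord π w := by
  simp [evalWord]

lemma exists_evalWord_inv (π : A → G) (w : List (A × Bool)) :
    ∃ v : List (A × Bool), v.length = w.length ∧ evalWord π v = (evalWord π w)⁻¹ := by
  induction w with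
  | nil => exact ⟨[], rfl, by simp [evalWord]⟩
  | cons p w ih =>
    obtain ⟨v, hv, hvw⟩ := ih
    refine ⟨v ++ [(p.1, !p.2)], by simp [hv], ?_⟩
    rw [evalWord_append, hvw]
    rcases p with ⟨x, _ | _⟩ <;> simp [evalWord]

lemma exists_evalWord_eq (hgen : Subgroup.closure (Set.range π) = ⊤) (g : G) :
    ∃ w : List (A × Bool), evalWord π w = g := by
  have hg : g ∈ Subgroup.closure (Set.range π) := hgen ▸ Subgroup.mem_top g
  induction hg using Subgroup.closure_induction with
  | mem x hx =>
    obtain ⟨y, rfl⟩ := hx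
    exact ⟨[(y, true)], by simp [evalWord]⟩
  | one => exact ⟨[], by simp [evalWord]⟩
  | mul x y _ _ hx hy =>
    obtain ⟨v, rfl⟩ := hx
    obtain ⟨w, rfl⟩ := hy
    exact ⟨v ++ w, evalWord_append π v w⟩
  | inv x _ hx =>
    obtain ⟨v, rfl⟩ := hx
    obtain ⟨w, -, hw⟩ := exists_evalWord_inv π v
    exact ⟨w, hw⟩

lemma wordLen_evalWord_le (π : A → G) (w : List (A × Bool)) :
    wordLen π (evalWord π w) ≤ w.length :=
  Nat.sInf_le ⟨w, rfl, rfl⟩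

lemma exists_evalWord_length_eq (hgen : Subgroup.closure (Set.range π) = ⊤) (g : G) :
    ∃ w : List (A × Bool), w.length = wordLen π g ∧ evalWord π w = g := by
  obtain ⟨w, hw⟩ := exists_evalWord_eq hgen g
  exact Nat.sInf_mem
    (s := {n | ∃ w : List (A × Bool), w.length = n ∧ evalWord π w = g}) ⟨_, w, rfl, hw⟩

lemma dX_mul_left (π : A → G) (h x y : G) : dX π (h * x) (h * y) = dX π x y := by
  unfold dX
  congr 1
  group

lemma dX_one_left (π : A → G) (x : G) : dX π 1 x = wordLen π x := by
  simp [dX]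

lemma dX_self (π : A → G) (x : G) : dX π x x = 0 := by
  have := wordLen_evalWord_le π []
  simpa [dX, evalWord] using this

lemma dX_comm (hgen : Subgroup.closure (Set.range π) = ⊤) (x y : G) :
    dX π x y = dX π y x := by
  have key : ∀ x y : G, dX π x y ≤ dX π y x := by
    intro x y
    obtain ⟨w, hw, hwg⟩ := exists_evalWord_length_eq hgen (y⁻¹ * x)
    obtain ⟨v, hv, hvw⟩ := exists_evalWord_inv π w
    have := wordLen_evalWord_le π v
    rw [hvw, hwg, hv, hw] at this
    simpa [dX] using this
  exact le_antisymm (key x y) (key y x)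

lemma dX_triangle (hgen : Subgroup.closure (Set.range π) = ⊤) (x y z : G) :
    dX π x z ≤ dX π x y + dX π y z := by
  obtain ⟨v, hv, hvg⟩ := exists_evalWord_length_eq hgen (x⁻¹ * y)
  obtain ⟨w, hw, hwg⟩ := exists_evalWord_length_eq hgen (y⁻¹ * z)
  have := wordLen_evalWord_le π (v ++ w)
  rw [evalWord_append, hvg, hwg, List.length_append, hv, hw] at this
  have e : x⁻¹ * y * (y⁻¹ * z) = x⁻¹ * z := by group
  rwa [e] at this

lemma exists_isDiscGeodesic_dX (hgen : Subgroup.closure (Set.range π) = ⊤) (x y : G) :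
    ∃ γ : ℕ → G, IsDiscGeodesic (dX π) x y γ := by
  obtain ⟨w, hw, hwg⟩ := exists_evalWord_length_eq hgen (x⁻¹ * y)
  change w.length = dX π x y at hw
  have h0 : x * evalWord π (w.take 0) = x := by simp [evalWord]
  have hn : x * evalWord π (w.take (dX π x y)) = y := by
    rw [← hw, List.take_length, hwg]; group
  have hle : ∀ i j, i ≤ j → j ≤ dX π x y →
      dX π (x * evalWord π (w.take i)) (x * evalWord π (w.take j)) ≤ j - i := by
    intro i j hij hj
    have e : w.take j = w.take i ++ (w.drop i).take (j - i) := by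
      rw [← List.take_add]; congr 1; omega
    rw [dX_mul_left, dX, e, evalWord_append, inv_mul_cancel_left]
    refine (wordLen_evalWord_le π _).trans ?_
    simp
  have heq : ∀ i j, i ≤ j → j ≤ dX π x y →
      dX π (x * evalWord π (w.take i)) (x * evalWord π (w.take j)) = j - i := by
    intro i j hij hj
    have h1 := hle 0 i (by omega) (by omega)
    have h2 := hle i j hij hj
    have h3 := hle j _ hj le_rfl
    rw [h0] at h1
    rw [hn] at h3
    have t1 := dX_triangle hgen x (x * evalWord π (w.take i)) y
    have t2 := dX_triangle hgen (x * evalWord π (w.take i)) (x * evalWord π (w.take j)) y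
    omega
  refine ⟨fun i => x * evalWord π (w.take i), h0, hn, fun i j hi hj => ?_⟩
  rcases le_total i j with h | h
  · simp only [heq i j h hj, Nat.dist]; omega
  · simp only [dX_comm hgen (x * evalWord π (w.take i)), heq j i h hi, Nat.dist]; omega

end WordMetric

/-! ## Discrete geodesics in a symmetric metric -/

section Geodesics

variable {X : Type*} {d : X → X → ℕ} {x y z : X} {γ γ₁ γ₂ : ℕ → X}

lemma IsDiscGeodesic.reverse (hd : ∀ a b, d a b = d b a) (hγ : IsDiscGeodesic d x y γ) :
    IsDiscGeodesic d y x fun i => γ (d x y - i) := by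
  obtain ⟨h0, h1, h2⟩ := hγ
  refine ⟨by simpa using h1, by simpa [hd y x] using h0, fun i j hi hj => ?_⟩
  rw [hd y x] at hi hj
  rw [h2 _ _ (by omega) (by omega)]
  simp only [Nat.dist]
  omega

lemma IsDiscGeodesic.dist_left (hγ : IsDiscGeodesic d x y γ) {i : ℕ} (hi : i ≤ d x y) :
    d x (γ i) = i := by
  have := hγ.2.2 0 i (Nat.zero_le _) hi
  rw [hγ.1] at this
  simpa [Nat.dist] using this

lemma IsDiscGeodesic.dist_right (hγ : IsDiscGeodesic d x y γ) {i : ℕ} (hi : i ≤ d x y) :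
    d (γ i) y = d x y - i := by
  have := hγ.2.2 i _ hi le_rfl
  rw [hγ.2.1] at this
  simp only [this, Nat.dist]
  omega

lemma DiscTrimTriangles.dist_le {δ : ℕ} (htrim : DiscTrimTriangles d δ)
    (h₁ : IsDiscGeodesic d z x γ₁) (h₂ : IsDiscGeodesic d z y γ₂) {i : ℕ}
    (hx : i ≤ d z x) (hy : i ≤ d z y) (hi : 2 * i + d x y ≤ d z x + d z y) :
    d (γ₁ i) (γ₂ i) ≤ δ := by
  refine htrim x y z γ₁ γ₂ h₁ h₂ i hx hy ?_
  have : (2 * i + d x y : ℝ) ≤ d z x + d z y := by exact_mod_cast hi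
  rw [gromovProd]
  linarith

end Geodesics

/-! ## The relative metric -/

section RelativeMetric

variable {A G : Type*} [Group G] {π : A → G} {H : Subgroup G}

lemma rcoset_mul_left {h : G} (hh : h ∈ H) (x : G) : rcoset H (h * x) = rcoset H x := by
  refine Quotient.sound ?_
  change QuotientGroup.rightRel H _ _
  rw [QuotientGroup.rightRel_apply]
  simpa using hh

lemma exists_eq_mul_of_rcoset_eq {x y : G} (hxy : rcoset H x = rcoset H y) :
    ∃ h ∈ H, x = h * y := by
  have : QuotientGroup.rightRel H x y := Quotient.exact hxy
  rw [QuotientGroup.rightRel_apply] at this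
  exact ⟨(y * x⁻¹)⁻¹, H.inv_mem this, by group⟩

lemma dY_le_dX (hgen : Subgroup.closure (Set.range π) = ⊤) {h : G} (hh : h ∈ H) (x y : G) :
    dY π H (rcoset H x) (rcoset H y) ≤ dX π x (h * y) := by
  obtain ⟨w, hw, hwg⟩ := exists_evalWord_length_eq hgen (x⁻¹ * (h * y))
  refine Nat.sInf_le ⟨w, hw, ?_⟩
  rw [hwg]
  change rcoset H (x * (x⁻¹ * (h * y))) = _
  rw [mul_inv_cancel_left, rcoset_mul_left hh]

lemma exists_dX_le_dY (hgen : Subgroup.closure (Set.range π) = ⊤) (x y : G) :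
    ∃ h ∈ H, dX π x (h * y) ≤ dY π H (rcoset H x) (rcoset H y) := by
  obtain ⟨v, hv⟩ := exists_evalWord_eq hgen (x⁻¹ * y)
  obtain ⟨w, hw, hwc⟩ := Nat.sInf_mem
    (s := {n | ∃ w : List (A × Bool), w.length = n ∧
      cosetMul H (rcoset H x) (evalWord π w) = rcoset H y})
    ⟨_, v, rfl, by
      rw [hv]
      change rcoset H (x * (x⁻¹ * y)) = _
      rw [mul_inv_cancel_left]⟩
  obtain ⟨h, hh, e⟩ := exists_eq_mul_of_rcoset_eq (x := x * evalWord π w) (y := y) hwc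
  refine ⟨h, hh, ?_⟩
  change _ ≤ sInf _
  rw [← hw, ← e, dX, inv_mul_cancel_left]
  exact wordLen_evalWord_le π w

lemma dY_rcoset_comm (hgen : Subgroup.closure (Set.range π) = ⊤) (x y : G) :
    dY π H (rcoset H x) (rcoset H y) = dY π H (rcoset H y) (rcoset H x) := by
  have key : ∀ x y : G,
      dY π H (rcoset H x) (rcoset H y) ≤ dY π H (rcoset H y) (rcoset H x) := by
    intro x y
    obtain ⟨h, hh, hle⟩ := exists_dX_le_dY (H := H) hgen y x
    refine (dY_le_dX hgen (H.inv_mem hh) x y).trans ?_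
    rwa [← dX_mul_left π h, mul_inv_cancel_left, dX_comm hgen]
  exact le_antisymm (key x y) (key y x)

lemma dY_rcoset_triangle (hgen : Subgroup.closure (Set.range π) = ⊤) (x y z : G) :
    dY π H (rcoset H x) (rcoset H z) ≤
      dY π H (rcoset H x) (rcoset H y) + dY π H (rcoset H y) (rcoset H z) := by
  obtain ⟨h, hh, hle⟩ := exists_dX_le_dY (H := H) hgen x y
  obtain ⟨k, hk, kle⟩ := exists_dX_le_dY (H := H) hgen y z
  have h1 := dY_le_dX hgen (H.mul_mem hh hk) x z
  have h2 := dX_triangle hgen x (h * y) (h * k * z)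
  rw [mul_assoc h k z, dX_mul_left] at h2
  rw [mul_assoc] at h1
  omega

/-- The label of a near-geodesic of `Y` exceeds the distance of its endpoints by at most `4`. -/
lemma length_le_of_isNearGeodesicPath (hgen : Subgroup.closure (Set.range π) = ⊤) {g f : G}
    {w : List (A × Bool)} (hw : IsNearGeodesicPath (dY π H) (rcoset H g) (rcoset H f)
      (cosetPath π H g w) w.length) :
    w.length ≤ dY π H (rcoset H g) (rcoset H f) + 4 := by
  obtain ⟨h0, hn, hpath, a, b, ha, hb, hab, hgeo⟩ := hw
  have hstep : ∀ i j, i ≤ j → j ≤ i + 1 → j ≤ w.length →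
      dY π H (cosetPath π H g w i) (cosetPath π H g w j) ≤ 1 := by
    intro i j hij hji hj
    rcases hij.eq_or_lt with rfl | h
    · have := dY_le_dX (π := π) hgen H.one_mem (g * evalWord π (w.take i))
        (g * evalWord π (w.take i))
      rw [one_mul, dX_self] at this
      exact this.trans zero_le_one
    · obtain rfl : j = i + 1 := by omega
      exact hpath i (by omega)
  have h1 := hstep 0 a (by omega) (by omega) (by omega)
  have h2 := hstep (w.length - b) w.length (by omega) (by omega) (by omega)
  have h3 := hgeo a (w.length - b) le_rfl (by omega) (by omega)
  rw [← h0, ← hn]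
  set p : ℕ → G := fun i => g * evalWord π (w.take i)
  have hp : ∀ i, cosetPath π H g w i = rcoset H (p i) := fun i => rfl
  simp only [hp] at h1 h2 h3 ⊢
  rw [dY_rcoset_comm hgen] at h1 h2
  have t1 := dY_rcoset_triangle (π := π) (H := H) hgen (p a) (p 0) (p (w.length - b))
  have t2 := dY_rcoset_triangle (π := π) (H := H) hgen (p 0) (p w.length) (p (w.length - b))
  omega

/-- A geodesic of `X` which is nearly as short as the distance in `Y` of its endpoints
projects to a path in `Y` which is geodesic up to an additive error. -/
lemma IsDiscGeodesic.le_dX_mul_add (hgen : Subgroup.closure (Set.range π) = ⊤) {x y : G}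
    {γ : ℕ → G} (hγ : IsDiscGeodesic (dX π) x y γ) {C : ℕ}
    (hC : dX π x y ≤ dY π H (rcoset H x) (rcoset H y) + C) {h : G} (hh : h ∈ H) {i j : ℕ}
    (hi : i ≤ dX π x y) (hj : j ≤ dX π x y) :
    j ≤ i + dX π (γ i) (h * γ j) + C := by
  have h1 := dY_le_dX (π := π) hgen hh x y
  have h2 := dX_triangle hgen x (γ i) (h * y)
  have h3 := dX_triangle hgen (γ i) (h * γ j) (h * y)
  rw [dX_mul_left, hγ.dist_right hj] at h3
  rw [hγ.dist_left hi] at h2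
  omega

/-- The lower bound of `IsDiscGeodesic.le_dX_mul_add` is inherited, with a larger error, by
pieces of geodesics contained in a neighbourhood of `γ`. -/
lemma le_dX_mul_add_of_close (hgen : Subgroup.closure (Set.range π) = ⊤) {x y x' y' : G}
    {γ σ : ℕ → G} (hγ : IsDiscGeodesic (dX π) x y γ) (hσ : IsDiscGeodesic (dX π) x' y' σ)
    {C δ : ℕ} (hC : dX π x y ≤ dY π H (rcoset H x) (rcoset H y) + C) {i j : ℕ}
    (hj : j ≤ dX π x' y') (hij : i ≤ j)
    (hi' : ∃ k ≤ dX π x y, dX π (σ i) (γ k) ≤ δ)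
    (hj' : ∃ k ≤ dX π x y, dX π (σ j) (γ k) ≤ δ) {h : G} (hh : h ∈ H) :
    j ≤ i + dX π (σ i) (h * σ j) + (4 * δ + C) := by
  obtain ⟨k, hk, hik⟩ := hi'
  obtain ⟨l, hl, hjl⟩ := hj'
  have e1 := hσ.2.2 i j (by omega) hj
  have e2 := hγ.2.2 k l hk hl
  have t1 := dX_triangle hgen (σ i) (γ k) (σ j)
  have t2 := dX_triangle hgen (γ k) (γ l) (σ j)
  have t3 := dX_triangle hgen (γ k) (σ i) (h * γ l)
  have t4 := dX_triangle hgen (σ i) (h * σ j) (h * γ l)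
  rw [dX_mul_left] at t4
  rw [dX_comm hgen (γ l)] at t2
  rw [dX_comm hgen (γ k) (σ i)] at t3
  simp only [Nat.dist] at e1 e2
  have key : Nat.dist k l ≤ dX π (γ k) (h * γ l) + C := by
    rcases le_total k l with hkl | hkl
    · have := hγ.le_dX_mul_add hgen hC hh hk hl
      simp only [Nat.dist]
      omega
    · have := hγ.le_dX_mul_add hgen hC (H.inv_mem hh) hl hk
      rw [← dX_mul_left π h, mul_inv_cancel_left, dX_comm hgen] at this
      simp only [Nat.dist]
      omega
  simp only [Nat.dist] at key
  omega

end RelativeMetric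

/-! ## Translates of shortest coset representatives -/

section Translate

variable {A G : Type*} [Group G] {π : A → G} {H : Subgroup G}

lemma ShortestInCoset.le_dX (hgen : Subgroup.closure (Set.range π) = ⊤) {g : G}
    (hg : ShortestInCoset π H g) {P : ℕ → G} (hP : IsDiscGeodesic (dX π) 1 g P) {k : ℕ}
    (hk : k ≤ dX π 1 g) {p : G} (hp : p ∈ H) : k ≤ dX π (P k) p := by
  have h1 := hg _ (H.inv_mem hp)
  have h2 := dX_triangle hgen p (P k) g
  rw [hP.dist_right hk, dX_comm hgen p (P k)] at h2
  rw [← dX_one_left] at h1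
  change _ ≤ dX π p g at h1
  omega

/-- If a segment of `[g, hg]` centred at the inscribed point of the triangle on `1, g, hg` is
geodesic modulo `H` up to the error `L`, then its length is bounded in terms of `δ, E, L`. -/
lemma central_segment_le (hgen : Subgroup.closure (Set.range π) = ⊤) {δ E L : ℕ}
    (htrim : DiscTrimTriangles (dX π) δ) (hqc : DiscQuasiconvex (dX π) (H : Set G) (E : ℝ))
    {g h : G} (hg : ShortestInCoset π H g) (hh : h ∈ H) {σ : ℕ → G}
    (hσ : IsDiscGeodesic (dX π) g (h * g) σ) {T N : ℕ}
    (hT : T = (dX π 1 g + dX π g (h * g) - dX π 1 (h * g)) / 2)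
    (hNT : N ≤ T) (hTN : T + N ≤ dX π g (h * g))
    (hlow : ∀ i j, T ≤ i + N → i ≤ j → j ≤ T + N → ∀ p ∈ H,
      j ≤ i + dX π (σ i) (p * σ j) + L) :
    N ≤ 100 * (δ + E + L + 1) := by
  have hcomm := dX_comm hgen
  have htri := dX_triangle hgen
  obtain ⟨P, hP⟩ := exists_isDiscGeodesic_dX hgen 1 g
  obtain ⟨Q, hQ⟩ := exists_isDiscGeodesic_dX hgen 1 (h * g)
  obtain ⟨S, hS⟩ := exists_isDiscGeodesic_dX hgen 1 h
  have hUlen : dX π h (h * g) = dX π 1 g := by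
    simpa using dX_mul_left π h 1 g
  have hU : IsDiscGeodesic (dX π) h (h * g) fun i => h * P i := by
    refine ⟨by simp [hP.1], by simp [hUlen, hP.2.1], fun i j hi hj => ?_⟩
    rw [hUlen] at hi hj
    rw [dX_mul_left, hP.2.2 i j hi hj]
  have hP' := hP.reverse hcomm
  have hQ' := hQ.reverse hcomm
  have hS' := hS.reverse hcomm
  have hU' := hU.reverse hcomm
  have hσ' := hσ.reverse hcomm
  have qc : ∀ k ≤ dX π 1 h, ∃ p ∈ H, dX π (S k) p ≤ E := by
    intro k hk
    obtain ⟨p, hp, hle⟩ := hqc 1 h S H.one_mem hh hS k hk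
    exact ⟨p, hp, by exact_mod_cast hle⟩
  have tg := fun k => htrim.dist_le (i := k) hσ hP'
  have thg := fun k => htrim.dist_le (i := k) hσ' hQ'
  have tSQ := fun k => htrim.dist_le (i := k) hS hQ
  have tQU := fun k => htrim.dist_le (i := k) hQ' hU'
  have tSU := fun k => htrim.dist_le (i := k) hS' hU
  have tPQ := fun k => htrim.dist_le (i := k) hP hQ
  have hfar := fun k => hg.le_dX (k := k) hgen hP
  have d1 := hP.dist_left (i := dX π 1 g - T)
  have m1 := htri 1 g (h * g)
  have m2 := htri 1 h (h * g)
  have m3 := htri 1 (h * g) g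
  have m4 := htri h 1 (h * g)
  have m5 := htri 1 (h * g) h
  have m6 := htri g 1 (h * g)
  simp only [hUlen, hcomm g 1, hcomm h 1, hcomm (h * g) g, hcomm (h * g) 1,
    hcomm (h * g) h] at *
  set a := dX π 1 g
  set b := dX π 1 (h * g)
  set n := dX π g (h * g)
  set e := dX π 1 h
  by_contra! hN
  -- the inscribed point of the triangle on `1, h, hg` is close to `h`
  have hw1 : e + a ≤ b + 2 * (E + δ) + 1 := by
    by_contra! hlt
    have hk := tSU (E + δ + 1) (by omega) (by omega) (by omega)
    obtain ⟨p, hp, hpE⟩ := qc (e - (E + δ + 1)) (by omega)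
    have h1 := hfar (E + δ + 1) (by omega) (H.mul_mem (H.inv_mem hh) hp)
    rw [← dX_mul_left π h, ← mul_assoc, mul_inv_cancel, one_mul] at h1
    have h2 := htri (h * P (E + δ + 1)) (S (e - (E + δ + 1))) p
    rw [hcomm (h * _) (S _)] at h2
    omega
  have hmin : a + b ≤ n + 2 * (E + 2 * δ) + 1 ∨ e + b ≤ a + 2 * (E + 2 * δ) + 1 := by
    by_contra! hlt
    have h1 := tPQ (E + 2 * δ + 1) (by omega) (by omega) (by omega)
    have h2 := tSQ (E + 2 * δ + 1) (by omega) (by omega) (by omega)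
    obtain ⟨p, hp, hpE⟩ := qc (E + 2 * δ + 1) (by omega)
    have h3 := hfar (E + 2 * δ + 1) (by omega) hp
    have h4 := htri (P (E + 2 * δ + 1)) (Q (E + 2 * δ + 1)) p
    have h5 := htri (Q (E + 2 * δ + 1)) (S (E + 2 * δ + 1)) p
    rw [hcomm (Q _) (S _)] at h5
    omega
  have hright : ∀ s, 1 ≤ s → s ≤ N → dX π (σ (T + s)) (Q (b + T + s - n)) ≤ δ := by
    intro s hs hsN
    have := thg (n - (T + s)) (by omega) (by omega) (by omega)
    rwa [show n - (n - (T + s)) = T + s by omega,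
      show b - (n - (T + s)) = b + T + s - n by omega] at this
  have hshort : e + b ≤ a + 2 * (3 * E + 7 * δ + L + 3) := by
    rcases hmin with hr | hm
    · by_contra! hlt
      set s := 2 * E + 5 * δ + L + 2 with hs
      have h1 := hright s (by omega) (by omega)
      have h2 := tSQ (b + T + s - n) (by omega) (by omega) (by omega)
      obtain ⟨p, hp, hpE⟩ := qc (b + T + s - n) (by omega)
      have h3 := tg T (by omega) (by omega) (by omega)
      have h4 := hlow T (T + s) (by omega) (by omega) (by omega) p⁻¹ (H.inv_mem hp)
      have h5 := htri (σ T) (P (a - T)) (p⁻¹ * σ (T + s))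
      have h6 := htri (P (a - T)) 1 (p⁻¹ * σ (T + s))
      have h7 : dX π 1 (p⁻¹ * σ (T + s)) = dX π p (σ (T + s)) := by
        rw [← dX_mul_left π p, mul_one, mul_inv_cancel_left]
      have h8 := htri p (S (b + T + s - n)) (σ (T + s))
      have h9 := htri (S (b + T + s - n)) (Q (b + T + s - n)) (σ (T + s))
      rw [hcomm p (S _)] at h8
      rw [hcomm (Q _) (σ _)] at h9
      rw [hcomm (P _) 1, d1 (by omega)] at h6
      omega
    · omega
  have h1 := hright N (by omega) le_rfl
  have h2 := tQU (n - (T + N)) (by omega) (by omega) (by omega)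
  have h3 := tg (T - N) (by omega) (by omega) (by omega)
  have h4 := hlow (T - N) (T + N) (by omega) (by omega) le_rfl h⁻¹ (H.inv_mem hh)
  rw [← dX_mul_left π h, mul_inv_cancel_left] at h4
  rw [show b - (n - (T + N)) = b + T + N - n by omega] at h2
  have h5 := htri (h * σ (T - N)) (h * P (a - (T - N))) (σ (T + N))
  have h6 := htri (h * P (a - (T - N))) (h * P (a - (n - (T + N)))) (σ (T + N))
  have h7 := htri (h * P (a - (n - (T + N)))) (Q (b + T + N - n)) (σ (T + N))
  rw [hcomm (h * P _) (Q _), hcomm (Q _) (σ _)] at h7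
  rw [dX_mul_left] at h5 h6
  have h8 := hP.2.2 (a - (T - N)) (a - (n - (T + N))) (by omega) (by omega)
  simp only [Nat.dist] at h8
  omega

end Translate

/-- **Lemma 4.2.** In the set-up above, write `h = h₁⁻¹h₂` and `f' = g·w̄`, and consider
geodesics `σ = [g, hg]`, `α = [g, f']`, `β = [hg, f']` in `X`.  Let `c` be the point of the
inscribed triple of the triangle `[1,g] ∪ σ ∪ [1,hg]` lying on `σ`, i.e. the point of `σ`
at distance `t_c = (1, hg)_g` (a Gromov product) from `g`.  Then there is a constant
`K₂ = K₂(H) > 0` such that any subsegment `ζ` of `σ` having `c` as its midpoint (say of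
half-length `ρ`) which is contained in the closed `δ`-neighbourhood of `α` or in the
closed `δ`-neighbourhood of `β` has length `l(ζ) = 2ρ ≤ K₂`. -/
theorem central_segment_of_sigma_not_close_to_bigon_sides
    {A G : Type*} [Group G] [Fintype A] (π : A → G)
    (hgen : Subgroup.closure (Set.range π) = ⊤)
    (δ : ℕ) (hδ : 10 ≤ δ) (htrim : DiscTrimTriangles (dX π) δ)
    (H : Subgroup G) (E : ℕ) (hqc : DiscQuasiconvex (dX π) (H : Set G) (E : ℝ)) :
    ∃ K₂ : ℝ, 0 < K₂ ∧
      ∀ (g f : G) (w u : List (A × Bool)) (h₁ h₂ : G),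
        BigonSetup π H g f w u h₁ h₂ →
        ∀ (σ α β : ℕ → G),
          IsDiscGeodesic (dX π) g (h₁⁻¹ * h₂ * g) σ →
          IsDiscGeodesic (dX π) g (g * evalWord π w) α →
          IsDiscGeodesic (dX π) (h₁⁻¹ * h₂ * g) (g * evalWord π w) β →
          ∀ ρ : ℝ, 0 ≤ ρ →
            0 ≤ gromovProd (dX π) 1 (h₁⁻¹ * h₂ * g) g - ρ →
            gromovProd (dX π) 1 (h₁⁻¹ * h₂ * g) g + ρ ≤ (dX π g (h₁⁻¹ * h₂ * g) : ℝ) →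
            ((∀ i ≤ dX π g (h₁⁻¹ * h₂ * g),
                |(i : ℝ) - gromovProd (dX π) 1 (h₁⁻¹ * h₂ * g) g| ≤ ρ →
                ∃ j ≤ dX π g (g * evalWord π w), (dX π (σ i) (α j) : ℝ) ≤ δ) ∨
             (∀ i ≤ dX π g (h₁⁻¹ * h₂ * g),
                |(i : ℝ) - gromovProd (dX π) 1 (h₁⁻¹ * h₂ * g) g| ≤ ρ →
                ∃ j ≤ dX π (h₁⁻¹ * h₂ * g) (g * evalWord π w),
                  (dX π (σ i) (β j) : ℝ) ≤ δ)) →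
            2 * ρ ≤ K₂ := by
  refine ⟨2 * (100 * (δ + E + (4 * δ + 4) + 1) + 2), by positivity, ?_⟩
  rintro g f w u h₁ h₂ ⟨hg, -, hh₁, hh₂, hw, hu, hnw, hnu⟩ σ α β hσ hα hβ ρ hρ hlo hhi hclose
  have hh : h₁⁻¹ * h₂ ∈ H := H.mul_mem (H.inv_mem hh₁) hh₂
  have hf : rcoset H (g * evalWord π w) = rcoset H f := by
    rw [← hw, rcoset_mul_left hh₁]
  have hCα : dX π g (g * evalWord π w) ≤
      dY π H (rcoset H g) (rcoset H (g * evalWord π w)) + 4 := by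
    rw [hf, dX, inv_mul_cancel_left]
    exact (wordLen_evalWord_le π w).trans (length_le_of_isNearGeodesicPath hgen hnw)
  have hCβ : dX π (h₁⁻¹ * h₂ * g) (g * evalWord π w) ≤
      dY π H (rcoset H (h₁⁻¹ * h₂ * g)) (rcoset H (g * evalWord π w)) + 4 := by
    have e : (h₁⁻¹ * h₂ * g)⁻¹ * (g * evalWord π w) = evalWord π u := by
      have : g * evalWord π w = h₁⁻¹ * (h₂ * (g * evalWord π u)) := by
        rw [hu, ← hw, inv_mul_cancel_left]
      rw [this]; group
    rw [hf, rcoset_mul_left hh, dX, e]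
    exact (wordLen_evalWord_le π u).trans (length_le_of_isNearGeodesicPath hgen hnu)
  generalize h₁⁻¹ * h₂ = h at *
  have htri := dX_triangle hgen 1 g (h * g)
  set T := (dX π 1 g + dX π g (h * g) - dX π 1 (h * g)) / 2 with hT
  set c := gromovProd (dX π) 1 (h * g) g with hc
  have hcval : 2 * c = dX π 1 g + dX π g (h * g) - dX π 1 (h * g) := by
    rw [hc, gromovProd, dX_comm hgen g 1]; ring
  have hT1 : (T : ℝ) ≤ c := by
    have : 2 * T + dX π 1 (h * g) ≤ dX π 1 g + dX π g (h * g) := by omega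
    have : (2 * T + dX π 1 (h * g) : ℝ) ≤ dX π 1 g + dX π g (h * g) := by exact_mod_cast this
    linarith
  have hT2 : c ≤ T + 1 / 2 := by
    have : dX π 1 g + dX π g (h * g) ≤ 2 * T + 1 + dX π 1 (h * g) := by omega
    have : (dX π 1 g + dX π g (h * g) : ℝ) ≤ 2 * T + 1 + dX π 1 (h * g) := by exact_mod_cast this
    linarith
  rcases lt_or_ge ρ 1 with hρ1 | hρ1
  · have : (0 : ℝ) ≤ 100 * (δ + E + (4 * δ + 4) + 1) := by positivity
    linarith
  set N := ⌊ρ⌋₊ - 1 with hN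
  have hfl : 1 ≤ ⌊ρ⌋₊ := Nat.le_floor (by simpa using hρ1)
  have hNfl : ((N : ℝ) + 1) = (⌊ρ⌋₊ : ℝ) := by
    have : N + 1 = ⌊ρ⌋₊ := by omega
    exact_mod_cast this
  have hN1 : (N : ℝ) + 1 ≤ ρ := hNfl ▸ Nat.floor_le hρ
  have hN2 : ρ < N + 2 := by
    have := Nat.lt_floor_add_one ρ
    linarith
  have hNT : N ≤ T := by
    have : (N : ℝ) ≤ T := by linarith
    exact_mod_cast this
  have hTN : T + N ≤ dX π g (h * g) := by
    have : (T + N : ℝ) ≤ dX π g (h * g) := by linarith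
    exact_mod_cast this
  have hrange : ∀ i, T ≤ i + N → i ≤ T + N → |(i : ℝ) - c| ≤ ρ := by
    intro i h1 h2
    have h1' : (T : ℝ) ≤ i + N := by exact_mod_cast h1
    have h2' : (i : ℝ) ≤ T + N := by exact_mod_cast h2
    rw [abs_le]
    constructor <;> linarith
  have hmain : N ≤ 100 * (δ + E + (4 * δ + 4) + 1) := by
    refine central_segment_le hgen htrim hqc hg hh hσ hT hNT hTN fun i j hi hij hj p hp => ?_
    have hri := hrange i hi (by omega)
    have hrj := hrange j (by omega) hj
    rcases hclose with hclose | hclose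
    · exact le_dX_mul_add_of_close hgen hα hσ hCα (by omega) hij
        (by exact_mod_cast hclose i (by omega) hri)
        (by exact_mod_cast hclose j (by omega) hrj) hp
    · exact le_dX_mul_add_of_close hgen hβ hσ hCβ (by omega) hij
        (by exact_mod_cast hclose i (by omega) hri)
        (by exact_mod_cast hclose j (by omega) hrj) hp
  have : (N : ℝ) ≤ 100 * (δ + E + (4 * δ + 4) + 1) := by exact_mod_cast hmain
  linarith
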